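/- arXiv:1712.03208 — 2 statements merged into one kernel-verified Lean document; each statement's English description precedes it below -/
import Mathlib

section
/- Fix k ≥ 2 and ℓ ≥ 1. If n ≥ C(k+ℓ, k-1) + C(k+ℓ-1, k-1), then there is no primitive K_{n-ℓ}^{(k)}-saturated hypergraph on n vertices. -/
open Finset

/-- The edge set `E` is `k`-uniform. -/
def Uniform (n k : ℕ) (E : Finset (Finset (Fin n))) : Prop :=
  ∀ e ∈ E, e.card = k

/-- `H` contains a copy of the complete `k`-uniform hypergraph on `r` vertices. -/
def HasClique (n k r : ℕ) (E : Finset (Finset (Fin n))) : Prop :=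
  ∃ Q : Finset (Fin n), Q.card = r ∧ ∀ T ⊆ Q, T.card = k → T ∈ E

/-- `H` is uniquely `K_r^(k)`-saturated: it has no `K_r^(k)`, and adding any
non-edge `k`-set `S` creates exactly one copy of `K_r^(k)`. -/
def UniquelySat (n k r : ℕ) (E : Finset (Finset (Fin n))) : Prop :=
  ¬ HasClique n k r E ∧
  ∀ S : Finset (Fin n), S.card = k → S ∉ E →
    ∃! Q : Finset (Fin n), Q.card = r ∧ ∀ T ⊆ Q, T.card = k → (T ∈ E ∨ T = S)

/-- `H` has no dominating vertex. -/
def Primitive (n k : ℕ) (E : Finset (Finset (Fin n))) : Prop :=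
  ¬ ∃ v : Fin n, ∀ S : Finset (Fin n), S.card = k → v ∈ S → S ∈ E

/-- `H` is a primitive uniquely `K_r^(k)`-saturated `k`-uniform hypergraph. -/
def IsPUS (n k r : ℕ) (E : Finset (Finset (Fin n))) : Prop :=
  Uniform n k E ∧ UniquelySat n k r E ∧ Primitive n k E

/-- `H` is `K_r^(k)`-saturated: no copy of `K_r^(k)`, and adding any non-edge
`k`-set creates at least one copy. -/
def Saturated (n k r : ℕ) (E : Finset (Finset (Fin n))) : Prop :=
  ¬ HasClique n k r E ∧
  ∀ S : Finset (Fin n), S.card = k → S ∉ E →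
    ∃ Q : Finset (Fin n), Q.card = r ∧ ∀ T ⊆ Q, T.card = k → (T ∈ E ∨ T = S)

namespace Tuza

set_option linter.unusedSectionVars false

theorem poly_bound {ι : Type*} [Fintype ι] [DecidableEq ι] (a b : ℕ) (q : ι → Fin b → Fin a → ℚ)
    (h : ι → Fin a → ℚ)
    (h1 : ∀ i, ∏ s, (q i s ⬝ᵥ h i) ≠ 0) (h2 : ∀ i j, i ≠ j → ∏ s, (q i s ⬝ᵥ h j) = 0) :
    Fintype.card ι ≤ (a + b - 1).choose b := by
  classical
  let w : Sym (Fin a) b → ι → ℚ := fun σ j => ((σ : Multiset (Fin a)).map (h j)).prod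
  have hw : ∀ i, (fun j => ∏ s, (q i s ⬝ᵥ h j)) ∈ Submodule.span ℚ (Set.range w) := by
    intro i
    have : (fun j => ∏ s, (q i s ⬝ᵥ h j)) = ∑ φ : Fin b → Fin a, (∏ s, q i s (φ s)) •
        w ⟨univ.val.map φ, by simp⟩ := by
      funext j
      simp only [dotProduct, Finset.sum_apply, Pi.smul_apply, smul_eq_mul, w]
      rw [Finset.prod_univ_sum]
      rw [Fintype.piFinset_univ]
      refine Finset.sum_congr rfl fun φ _ => ?_
      rw [Finset.prod_mul_distrib]
      simp [Finset.prod]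
      left; rfl
    rw [this]
    exact Submodule.sum_mem _ fun φ _ => Submodule.smul_mem _ _ (Submodule.subset_span ⟨_, rfl⟩)
  have htop : Submodule.span ℚ (Set.range w) = ⊤ := by
    rw [eq_top_iff]
    intro v _
    have : v = ∑ i, (v i / ∏ s, (q i s ⬝ᵥ h i)) • (fun j => ∏ s, (q i s ⬝ᵥ h j)) := by
      funext j
      simp only [Finset.sum_apply, Pi.smul_apply, smul_eq_mul]
      rw [Finset.sum_eq_single j]
      · rw [div_mul_cancel₀ _ (h1 j)]
      · intro i _ hij
        rw [h2 i j hij, mul_zero]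
      · simp
    rw [this]
    exact Submodule.sum_mem _ fun i _ => Submodule.smul_mem _ _ (hw i)
  have h3 := finrank_range_le_card (R := ℚ) w
  rw [Set.finrank, htop, finrank_top, Module.finrank_fintype_fun_eq_card,
    Sym.card_sym_eq_choose, Fintype.card_fin] at h3
  exact h3

variable {V : Type*} [Fintype V] [DecidableEq V]

theorem exists_orth {k : ℕ} (p : V → Fin k → ℚ) (G : Finset V) (hG : G.card + 1 = k) :
    ∃ h : Fin k → ℚ, h ≠ 0 ∧ ∀ v ∈ G, p v ⬝ᵥ h = 0 := by
  let f : (Fin k → ℚ) →ₗ[ℚ] (G → ℚ) := (Matrix.of fun v : G => p v).mulVecLin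
  have hf : LinearMap.ker f ≠ ⊥ := by
    apply LinearMap.ker_ne_bot_of_finrank_lt
    simp; omega
  obtain ⟨h, hh, h0⟩ := Submodule.exists_mem_ne_zero_of_ne_bot hf
  refine ⟨h, h0, fun v hv => ?_⟩
  have := congrFun (LinearMap.mem_ker.1 hh) ⟨v, hv⟩
  simpa [f, Matrix.mulVec] using this

theorem realize_base (k : ℕ) : ∃ p : V → Fin k → ℚ, ∀ A : Finset V, A.card = k →
    ∀ h, (∀ v ∈ A, p v ⬝ᵥ h = 0) → h = 0 := by
  let ix : V → ℚ := fun v => ((Fintype.equivFin V v : ℕ) : ℚ)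
  have hix : Function.Injective ix := by
    intro x y hxy
    have : (Fintype.equivFin V x : ℕ) = (Fintype.equivFin V y : ℕ) := by
      have hxy2 : ((Fintype.equivFin V x : ℕ) : ℚ) = ((Fintype.equivFin V y : ℕ) : ℚ) := hxy
      exact_mod_cast hxy2
    exact (Fintype.equivFin V).injective (Fin.ext this)
  refine ⟨fun v i => ix v ^ (i : ℕ), fun A hA h hh => ?_⟩
  let g : Fin k ≃ A := (A.equivFinOfCardEq hA).symm
  have hdet : (Matrix.vandermonde fun i => ix (g i)).det ≠ 0 := by
    rw [Matrix.det_vandermonde_ne_zero_iff]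
    intro x y hxy
    exact g.injective (Subtype.ext (hix hxy))
  apply Matrix.eq_zero_of_mulVec_eq_zero hdet
  funext i
  exact hh (g i) (g i).2

theorem realize (k : ℕ) {ι : Type*} [LinearOrder ι] (e : ι → Finset V) (hk : ∀ i, (e i).card = k)
    (hI : ∀ i j, i ≠ j → (e i ∩ e j).card + 2 ≤ k)
    (hx : ∀ i, ∃ x ∈ e i, ∀ j < i, x ∉ e j) (I : Finset ι) :
    ∃ p : V → Fin k → ℚ, (∀ A : Finset V, A.card = k → (∀ i ∈ I, A ≠ e i) →
      ∀ h, (∀ v ∈ A, p v ⬝ᵥ h = 0) → h = 0) ∧ ∀ i ∈ I, ∃ h, h ≠ 0 ∧ ∀ v ∈ e i, p v ⬝ᵥ h = 0 := by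
  classical
  induction I using Finset.induction_on_max with
  | empty =>
    obtain ⟨p, hp⟩ := realize_base (V := V) k
    exact ⟨p, fun A hA _ => hp A hA, by simp⟩
  | insert m s hm ih =>
    obtain ⟨p, hp1, hp2⟩ := ih
    obtain ⟨x, hxm, hxj⟩ := hx m
    have hR : ((e m).erase x).card + 1 = k := by
      rw [Finset.card_erase_add_one hxm, hk]
    obtain ⟨h0, h0ne, h0R⟩ := exists_orth p _ hR
    -- family of hyperplanes to be avoided
    let ℬ : Type _ := {B : Finset V // B.card + 1 = k ∧ x ∉ B ∧ B ≠ (e m).erase x}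
    have hB : ∀ B : ℬ, ∃ h : Fin k → ℚ, h ≠ 0 ∧ ∀ v ∈ B.1, p v ⬝ᵥ h = 0 :=
      fun B => exists_orth p B.1 B.2.1
    choose hb hbne hbB using hB
    let W : Submodule ℚ (Fin k → ℚ) := LinearMap.ker (dotProductBilin ℚ ℚ h0)
    have hW : ∀ y, y ∈ W ↔ y ⬝ᵥ h0 = 0 := by
      intro y
      simp [W, dotProduct_comm]
    have hprop : ∀ B : ℬ, ∀ h, (∀ v ∈ B.1, p v ⬝ᵥ h = 0) → ∃ c : ℚ, h = c • hb B := by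
      intro B h hh
      have hA : (insert x B.1).card = k := by rw [card_insert_of_notMem B.2.2.1, B.2.1]
      have hAn : ∀ i ∈ s, insert x B.1 ≠ e i := by
        intro i hi hc
        exact hxj i (hm i hi) (hc ▸ mem_insert_self _ _)
      have hne : p x ⬝ᵥ hb B ≠ 0 := by
        intro hz
        apply hbne B
        apply hp1 _ hA hAn
        intro v hv
        rcases mem_insert.1 hv with rfl | hv
        · exact hz
        · exact hbB B v hv
      refine ⟨(p x ⬝ᵥ h) / (p x ⬝ᵥ hb B), ?_⟩
      rw [← sub_eq_zero]
      apply hp1 _ hA hAn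
      intro v hv
      rw [dotProduct_sub, dotProduct_smul, smul_eq_mul]
      rcases mem_insert.1 hv with rfl | hv
      · rw [div_mul_cancel₀ _ hne, sub_self]
      · rw [hbB B v hv, hh v hv]; simp
    have hex : ∃ y ∈ W, ∀ B : ℬ, y ⬝ᵥ hb B ≠ 0 := by
      let fB : ℬ → Module.Dual ℚ W := fun B => (dotProductBilin ℚ ℚ (hb B)).comp W.subtype
      have hfB : ∀ B, ∃ y : W, fB B y ≠ 0 := by
        intro B
        by_contra hcon
        push Not at hcon
        -- then hb B is proportional to h0
        have hcon' : ∀ y, y ⬝ᵥ h0 = 0 → y ⬝ᵥ hb B = 0 := by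
          intro y hy
          have := hcon ⟨y, (hW y).2 hy⟩
          simpa [fB, dotProduct_comm] using this
        have hh0 : h0 ⬝ᵥ h0 ≠ 0 := by
          intro hz; exact h0ne (dotProduct_self_eq_zero.1 hz)
        have hpr : hb B = ((hb B ⬝ᵥ h0) / (h0 ⬝ᵥ h0)) • h0 := by
          set c := (hb B ⬝ᵥ h0) / (h0 ⬝ᵥ h0) with hc
          have e1 : (hb B - c • h0) ⬝ᵥ h0 = 0 := by
            rw [sub_dotProduct, smul_dotProduct, smul_eq_mul, hc, div_mul_cancel₀ _ hh0, sub_self]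
          have e2 := hcon' _ e1
          rw [← sub_eq_zero, ← dotProduct_self_eq_zero]
          rw [dotProduct_sub, dotProduct_smul, e1, e2]; simp
        have hcne : (hb B ⬝ᵥ h0) / (h0 ⬝ᵥ h0) ≠ 0 := by
          intro hz; rw [hz, zero_smul] at hpr; exact hbne B hpr
        have h0B : ∀ v ∈ B.1, p v ⬝ᵥ h0 = 0 := by
          intro v hv
          have := hbB B v hv
          rw [hpr, dotProduct_smul, smul_eq_mul] at this
          exact (mul_eq_zero.1 this).resolve_left hcne
        have : ∃ v ∈ B.1, v ∉ (e m).erase x := by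
          by_contra hsub
          push Not at hsub
          exact B.2.2.2 (Finset.eq_of_subset_of_card_le hsub (by have := B.2.1; omega))
        obtain ⟨v, hvB, hvR⟩ := this
        apply h0ne
        apply hp1 (insert v ((e m).erase x)) (by rw [card_insert_of_notMem hvR, hR])
        · intro i hi hc
          have hsub : (e m).erase x ⊆ e i ∩ e m := by
            intro u hu
            exact mem_inter.2 ⟨hc ▸ mem_insert_of_mem hu, mem_of_mem_erase hu⟩
          have := card_le_card hsub
          have := hI i m (hm i hi).ne
          omega
        · intro u hu
          rcases mem_insert.1 hu with rfl | hu
          · exact h0B _ hvB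
          · exact h0R u hu
      obtain ⟨y, hy⟩ := Module.Dual.exists_forall_ne_zero_of_forall_exists fB hfB
      refine ⟨y, y.2, fun B => ?_⟩
      have := hy B
      simpa [fB, dotProduct_comm] using this
    obtain ⟨y, hyW, hyB⟩ := hex
    refine ⟨Function.update p x y, ?_, ?_⟩
    · intro A hA hAn h hh
      have hold : ∀ v ∈ A, v ≠ x → p v ⬝ᵥ h = 0 := by
        intro v hv hvx
        have := hh v hv
        rwa [Function.update_of_ne hvx] at this
      by_cases hxA : x ∈ A
      · let B : ℬ := ⟨A.erase x, by rw [card_erase_add_one hxA, hA], by simp, by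
          intro hc
          apply hAn m (mem_insert_self _ _)
          rw [← insert_erase hxA, hc, insert_erase hxm]⟩
        obtain ⟨c, rfl⟩ := hprop B h (fun v hv => hold v (mem_of_mem_erase hv) (ne_of_mem_erase hv))
        have := hh x hxA
        rw [Function.update_self, dotProduct_smul, smul_eq_mul] at this
        rw [(mul_eq_zero.1 this).resolve_right (hyB B), zero_smul]
      · apply hp1 A hA (fun i hi => hAn i (mem_insert_of_mem hi))
        intro v hv
        exact hold v hv (fun hc => hxA (hc ▸ hv))
    · intro i hi
      rcases mem_insert.1 hi with rfl | hi
      · refine ⟨h0, h0ne, fun v hv => ?_⟩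
        by_cases hvx : v = x
        · subst hvx; rw [Function.update_self]; exact (hW y).1 hyW
        · rw [Function.update_of_ne hvx]; exact h0R v (mem_erase.2 ⟨hvx, hv⟩)
      · obtain ⟨h, hne, hh⟩ := hp2 i hi
        refine ⟨h, hne, fun v hv => ?_⟩
        have hvx : v ≠ x := fun hc => hxj i (hm i hi) (hc ▸ hv)
        rw [Function.update_of_ne hvx]; exact hh v hv
end Tuza

namespace Tuza
set_option linter.unusedSectionVars false
variable {V : Type*} [Fintype V] [DecidableEq V]

structure Sys (a b : ℕ) (𝒜 : Finset (Finset V)) (t : Finset V → Fin b → V) : Prop where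
  card : ∀ A ∈ 𝒜, A.card = a
  dis : ∀ A ∈ 𝒜, ∀ s, t A s ∉ A
  hit : ∀ A ∈ 𝒜, ∀ A' ∈ 𝒜, A ≠ A' → ∃ s, t A s ∈ A'

theorem Sys.mono {a b : ℕ} {𝒜 ℬ : Finset (Finset V)} {t : Finset V → Fin b → V}
    (h : Sys a b 𝒜 t) (hs : ℬ ⊆ 𝒜) : Sys a b ℬ t :=
  ⟨fun A hA => h.card A (hs hA), fun A hA => h.dis A (hs hA),
    fun A hA A' hA' => h.hit A (hs hA) A' (hs hA')⟩

theorem bollobas {a b : ℕ} {𝒜 : Finset (Finset V)} {t : Finset V → Fin b → V}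
    (h : Sys a b 𝒜 t) : 𝒜.card ≤ (a + b).choose b := by
  obtain ⟨p, hp⟩ := realize_base (V := V) (a + 1)
  have hex : ∀ A : 𝒜, ∃ g : Fin (a + 1) → ℚ, g ≠ 0 ∧ ∀ v ∈ A.1, p v ⬝ᵥ g = 0 :=
    fun A => exists_orth p A.1 (by rw [h.card A.1 A.2])
  choose g hg0 hg using hex
  have := poly_bound (ι := 𝒜) (a + 1) b (fun A s => p (t A.1 s)) g ?_ ?_
  · rw [Fintype.card_coe] at this
    have e : a + 1 + b - 1 = a + b := by omega
    rwa [e] at this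
  · intro A
    rw [Finset.prod_ne_zero_iff]
    intro s _ hz
    apply hg0 A
    apply hp (insert (t A.1 s) A.1)
    · rw [card_insert_of_notMem (h.dis A.1 A.2 s), h.card A.1 A.2]
    · intro v hv
      rcases mem_insert.1 hv with rfl | hv
      · exact hz
      · exact hg A v hv
  · intro A A' hne
    obtain ⟨s, hs⟩ := h.hit A.1 A.2 A'.1 A'.2 (fun hc => hne (Subtype.ext hc))
    exact Finset.prod_eq_zero (mem_univ s) (hg A' _ hs)

theorem reduce {a b : ℕ} {𝒞 : Finset (Finset V)} {t : Finset V → Fin b → V}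
    (h : Sys (a + 1) b 𝒞 t) (x : Finset V → V) (hx : ∀ A ∈ 𝒞, x A ∈ A)
    (hp : ∀ A ∈ 𝒞, ∀ A' ∈ 𝒞, A ≠ A' → x A ∉ A') :
    ∃ t', Sys a b (𝒞.image (fun A => A.erase (x A))) t' := by
  classical
  have hcard : ∀ A ∈ 𝒞, (A.erase (x A)).card = a := by
    intro A hA
    rw [card_erase_of_mem (hx A hA), h.card A hA]; rfl
  have key : ∀ R : Finset V, ∃ u : Fin b → V, R ∈ 𝒞.image (fun A => A.erase (x A)) →
      (∀ s, u s ∉ R) ∧ ∀ A' ∈ 𝒞, R ≠ A'.erase (x A') → ∃ s, u s ∈ A'.erase (x A') := by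
    intro R
    by_cases hR : R ∈ 𝒞.image (fun A => A.erase (x A))
    swap
    · by_cases hV : Nonempty (Fin b → V)
      · obtain ⟨u⟩ := hV
        exact ⟨u, fun hc => absurd hc hR⟩
      · exact ⟨t R, fun hc => absurd hc hR⟩
    obtain ⟨A, hA, rfl⟩ := mem_image.1 hR
    have hy : ∀ s, ∃ y, y ∉ A.erase (x A) ∧ ∀ A' ∈ 𝒞, A.erase (x A) ≠ A'.erase (x A') →
        t A s ∈ A' → y ∈ A'.erase (x A') := by
      intro s
      have ht : t A s ∉ A.erase (x A) := fun hc => h.dis A hA s (mem_of_mem_erase hc)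
      by_cases hc : ∃ A' ∈ 𝒞, A.erase (x A) ≠ A'.erase (x A') ∧ t A s = x A'
      · obtain ⟨A', hA', hne, hts⟩ := hc
        have : ∃ y ∈ A'.erase (x A'), y ∉ A.erase (x A) := by
          by_contra hcon
          push Not at hcon
          exact hne (eq_of_subset_of_card_le hcon (by rw [hcard A hA, hcard A' hA'])).symm
        obtain ⟨y, hy1, hy2⟩ := this
        refine ⟨y, hy2, fun A'' hA'' _ hm => ?_⟩
        have : A' = A'' := by
          by_contra hne'
          exact hp A' hA' A'' hA'' hne' (hts ▸ hm)
        rw [← this]; exact hy1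
      · push Not at hc
        exact ⟨t A s, ht, fun A' hA' hne hm => mem_erase.2 ⟨hc A' hA' hne, hm⟩⟩
    choose u hu1 hu2 using hy
    refine ⟨u, fun _ => ⟨hu1, fun A' hA' hne => ?_⟩⟩
    obtain ⟨s, hs⟩ := h.hit A hA A' hA' (by rintro rfl; exact hne rfl)
    exact ⟨s, hu2 s A' hA' hne hs⟩
  choose t' ht' using key
  refine ⟨t', ?_, ?_, ?_⟩
  · intro R hR
    obtain ⟨A, hA, rfl⟩ := mem_image.1 hR
    exact hcard A hA
  · intro R hR
    exact (ht' R hR).1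
  · intro R hR R' hR' hne
    obtain ⟨A', hA', rfl⟩ := mem_image.1 hR'
    exact (ht' R hR).2 A' hA' hne

theorem min_cover (𝒜 : Finset (Finset V)) : ∃ 𝒞 ⊆ 𝒜, 𝒞.biUnion id = 𝒜.biUnion id ∧
    ∀ A ∈ 𝒞, ∃ x ∈ A, ∀ A' ∈ 𝒞, A ≠ A' → x ∉ A' := by
  classical
  induction h : 𝒜.card using Nat.strong_induction_on generalizing 𝒜 with
  | _ m ih =>
    by_cases hc : ∀ A ∈ 𝒜, ∃ x ∈ A, ∀ A' ∈ 𝒜, A ≠ A' → x ∉ A'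
    · exact ⟨𝒜, Subset.rfl, rfl, hc⟩
    · push Not at hc
      obtain ⟨A, hA, hA2⟩ := hc
      obtain ⟨𝒞, h1, h2, h3⟩ := ih (𝒜.erase A).card (by rw [← h]; exact card_erase_lt_of_mem hA) _ rfl
      refine ⟨𝒞, h1.trans (erase_subset _ _), ?_, h3⟩
      rw [h2]
      ext v
      simp only [mem_biUnion, id, mem_erase]
      constructor
      · rintro ⟨B, ⟨_, hB⟩, hv⟩; exact ⟨B, hB, hv⟩
      · rintro ⟨B, hB, hv⟩
        by_cases hBA : B = A
        · subst hBA
          obtain ⟨A', hA', hne, hv'⟩ := hA2 v hv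
          exact ⟨A', ⟨hne.symm, hA'⟩, hv'⟩
        · exact ⟨B, ⟨hBA, hB⟩, hv⟩

theorem union_step {a b N : ℕ} {𝒢 : Finset (Finset V)} {t : Finset V → Fin b → V}
    (h : Sys (a + 1) b 𝒢 t)
    (ih : ∀ (𝒜 : Finset (Finset V)) (t : Finset V → Fin b → V), Sys a b 𝒜 t →
      (𝒜.biUnion id).card + 1 ≤ N) :
    (𝒢.biUnion id).card + 1 ≤ 𝒢.card + N := by
  classical
  obtain ⟨𝒞, h1, h2, h3⟩ := min_cover 𝒢
  by_cases hV : Nonempty V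
  swap
  · have he : (𝒢.biUnion id) = ∅ := by
      ext v; exact absurd ⟨v⟩ hV
    have : (1 : ℕ) ≤ N := by
      have := ih ∅ t ⟨by simp, by simp, by simp⟩
      simpa using this
    rw [he, card_empty]; omega
  have h4 : ∀ A : Finset V, ∃ x, A ∈ 𝒞 → x ∈ A ∧ ∀ A' ∈ 𝒞, A ≠ A' → x ∉ A' := by
    intro A
    by_cases hA : A ∈ 𝒞
    · obtain ⟨x, hx⟩ := h3 A hA; exact ⟨x, fun _ => hx⟩
    · obtain ⟨x⟩ := hV; exact ⟨x, fun hc => absurd hc hA⟩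
  choose x hx using h4
  obtain ⟨t', ht'⟩ := reduce (h.mono h1) x (fun A hA => (hx A hA).1) (fun A hA => (hx A hA).2)
  have := ih _ _ ht'
  rw [← h2]
  have hsub : 𝒞.biUnion id ⊆ 𝒞.image x ∪ (𝒞.image (fun A => A.erase (x A))).biUnion id := by
    intro v hv
    obtain ⟨A, hA, hv⟩ := mem_biUnion.1 hv
    by_cases hvx : v = x A
    · exact mem_union_left _ (mem_image.2 ⟨A, hA, hvx.symm⟩)
    · exact mem_union_right _ (mem_biUnion.2 ⟨_, mem_image_of_mem _ hA, mem_erase.2 ⟨hvx, hv⟩⟩)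
  have c1 := card_le_card hsub
  have c2 := card_union_le (𝒞.image x) ((𝒞.image (fun A => A.erase (x A))).biUnion id)
  have c3 : (𝒞.image x).card ≤ 𝒞.card := card_image_le
  have c4 := card_le_card h1
  omega

theorem union_bound {b : ℕ} (a : ℕ) : ∀ (𝒜 : Finset (Finset V)) (t : Finset V → Fin b → V),
    Sys a b 𝒜 t → (𝒜.biUnion id).card + 1 ≤ (a + b + 1).choose a := by
  induction a with
  | zero =>
    intro 𝒜 t h
    have : 𝒜.biUnion id = ∅ := by
      ext v
      simp only [mem_biUnion, id, notMem_empty, iff_false]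
      rintro ⟨A, hA, hv⟩
      rw [card_eq_zero.1 (h.card A hA)] at hv
      simp at hv
    simp [this]
  | succ a ih =>
    intro 𝒜 t h
    have h1 := union_step h ih
    have h2 := bollobas h
    have h3 : (a + 1 + b).choose b = (a + 1 + b).choose (a + 1) := by
      rw [← Nat.choose_symm_add]
    have h4 : (a + 1 + b + 1).choose (a + 1) = (a + 1 + b).choose a + (a + 1 + b).choose (a + 1) :=
      Nat.choose_succ_succ _ _
    have h5 : a + b + 1 = a + 1 + b := by omega
    rw [h5] at h1
    omega
end Tuza

namespace Tuza
set_option linter.unusedSectionVars false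
variable {V : Type*} [Fintype V] [DecidableEq V]

structure Crit (k b : ℕ) (F : Finset (Finset V)) : Prop where
  card : ∀ e ∈ F, e.card = k
  tau : ∀ T : Finset V, T.card ≤ b → ∃ e ∈ F, ∀ v ∈ e, v ∉ T
  crit : ∀ e ∈ F, ∃ T : Finset V, T.card = b ∧ ∀ f ∈ F, f ≠ e → ∃ v ∈ f, v ∈ T
  cov : ∀ v, ∃ e ∈ F, v ∈ e

theorem Crit.sys {k b : ℕ} {F : Finset (Finset V)} (h : Crit k b F) : ∃ t, Sys k b F t := by
  classical
  have key : ∀ e : Finset V, ∃ u : Fin b → V, e ∈ F →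
      (∀ s, u s ∉ e) ∧ ∀ f ∈ F, e ≠ f → ∃ s, u s ∈ f := by
    have hF : ∀ e ∈ F, ∃ u : Fin b → V, (∀ s, u s ∉ e) ∧ ∀ f ∈ F, e ≠ f → ∃ s, u s ∈ f := by
      intro e he
      obtain ⟨T, hT, hT2⟩ := h.crit e he
      let g := (T.equivFinOfCardEq hT)
      refine ⟨fun s => (g.symm s : V), fun s hs => ?_, fun f hf hne => ?_⟩
      · obtain ⟨f, hf, hfT⟩ := h.tau T hT.le
        have hfe : f = e := by
          by_contra hne
          obtain ⟨v, hv, hvT⟩ := hT2 f hf hne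
          exact hfT v hv hvT
        exact hfT _ (hfe ▸ hs) (g.symm s).2
      · obtain ⟨v, hv, hvT⟩ := hT2 f hf hne.symm
        exact ⟨g ⟨v, hvT⟩, by simpa using hv⟩
    intro e
    by_cases he : e ∈ F
    · obtain ⟨u, hu⟩ := hF e he; exact ⟨u, fun _ => hu⟩
    · obtain ⟨f, hf, _⟩ := h.tau ∅ (by simp)
      obtain ⟨u, hu⟩ := hF f hf; exact ⟨u, fun hc => absurd hc he⟩
  choose t ht using key
  exact ⟨t, h.card, fun A hA => (ht A hA).1, fun A hA => (ht A hA).2⟩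

def nb (F : Finset (Finset V)) (S : Finset V) : Finset V := 
  univ.filter fun r => ∃ s ∈ S, ({s, r} : Finset V) ∈ F

theorem mem_nb {F : Finset (Finset V)} {S : Finset V} {r : V} :
    r ∈ nb F S ↔ ∃ s ∈ S, ({s, r} : Finset V) ∈ F := by simp [nb]

theorem nb_disj {F : Finset (Finset V)} {S : Finset V} (hS : ∀ e ∈ F, ¬ e ⊆ S) {r : V}
    (hr : r ∈ nb F S) : r ∉ S := by
  intro hc
  obtain ⟨s, hs, he⟩ := mem_nb.1 hr
  apply hS _ he
  intro v hv
  rcases mem_insert.1 hv with rfl | hv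
  · exact hs
  · rw [mem_singleton.1 hv]; exact hc

theorem pair_of_mem {e : Finset V} (he : e.card = 2) {v : V} (hv : v ∈ e) : ∃ r, e = {v, r} := by
  have : (e.erase v).card = 1 := by rw [card_erase_of_mem hv, he]
  obtain ⟨r, hr⟩ := card_eq_one.1 this
  exact ⟨r, by rw [← insert_erase hv, hr]⟩

theorem hajnal {b : ℕ} {F : Finset (Finset V)} (h : Crit 2 b F) (S : Finset V)
    (hS : ∀ e ∈ F, ¬ e ⊆ S) : S.card ≤ (nb F S).card := by
  classical
  induction hm : S.card using Nat.strong_induction_on generalizing S with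
  | _ m ih =>
    by_contra hlt
    push Not at hlt
    have hne : S.Nonempty := by rw [← card_pos]; omega
    obtain ⟨x, hx⟩ := hne
    have hall : ∀ A : Finset {s // s ∈ S.erase x}, A.card ≤
        (A.biUnion fun s => nb F {s.1}).card := by
      intro A
      have h1 : (A.map (Function.Embedding.subtype _)) ⊆ S.erase x := by
        intro v hv
        obtain ⟨w, _, rfl⟩ := mem_map.1 hv
        exact w.2
      have h2 := card_le_card h1
      have h2' := card_erase_lt_of_mem hx
      have h3 := ih _ (by omega) (A.map (Function.Embedding.subtype _))
        (fun e he hc => hS e he (hc.trans (h1.trans (erase_subset _ _)))) rfl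
      rw [card_map] at h3
      refine h3.trans (card_le_card ?_)
      intro r hr
      obtain ⟨s, hs, he⟩ := mem_nb.1 hr
      obtain ⟨w, hw, rfl⟩ := mem_map.1 hs
      exact mem_biUnion.2 ⟨w, hw, mem_nb.2 ⟨w.1, by simp, he⟩⟩
    obtain ⟨φ, hφi, hφ⟩ := (Finset.all_card_le_biUnion_card_iff_exists_injective _).1 hall
    have hφe : ∀ s, ({s.1, φ s} : Finset V) ∈ F := by
      intro s
      obtain ⟨s', hs', he⟩ := mem_nb.1 (hφ s)
      rw [mem_singleton.1 hs'] at he; exact he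
    have him : (univ.image φ) = nb F S := by
      apply eq_of_subset_of_card_le
      · intro r hr
        obtain ⟨s, _, rfl⟩ := mem_image.1 hr
        exact mem_nb.2 ⟨s.1, mem_of_mem_erase s.2, hφe s⟩
      · rw [card_image_of_injective _ hφi, card_univ, Fintype.card_coe, card_erase_of_mem hx]
        omega
    obtain ⟨g, hg, hxg⟩ := h.cov x
    obtain ⟨r, rfl⟩ := pair_of_mem (h.card g hg) hxg
    obtain ⟨T, hT, hT2⟩ := h.crit _ hg
    have hother : ∀ f ∈ F, ∀ v ∈ f, v ∈ S → ∃ w ∈ f, w ∈ nb F S := by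
      intro f hf v hv hvS
      obtain ⟨w, rfl⟩ := pair_of_mem (h.card f hf) hv
      exact ⟨w, by simp, mem_nb.2 ⟨v, hvS, hf⟩⟩
    obtain ⟨f, hf, hfT⟩ := h.tau ((T \ S) ∪ nb F S) (by
      have h1 : (T \ S) ∪ nb F S ⊆ (T \ S) ∪
          (T ∩ S).image (fun s => if hs : s ∈ S.erase x then φ ⟨s, hs⟩ else s) := by
        intro v hv
        rcases mem_union.1 hv with hv | hv
        · exact mem_union_left _ hv
        · by_cases hvT : v ∈ T
          · exact mem_union_left _ (mem_sdiff.2 ⟨hvT, nb_disj hS hv⟩)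
          · apply mem_union_right
            have hv' := hv
            rw [← him] at hv'
            obtain ⟨s, _, rfl⟩ := mem_image.1 hv'
            have hxn : x ∉ ({s.1, φ s} : Finset V) := by
              intro hc
              rcases mem_insert.1 hc with hc | hc
              · exact (ne_of_mem_erase s.2) hc.symm
              · exact nb_disj hS hv (mem_singleton.1 hc ▸ hx)
            obtain ⟨w, hw, hwT⟩ := hT2 _ (hφe s) (fun hc => hxn (hc ▸ mem_insert_self _ _))
            rcases mem_insert.1 hw with rfl | hw
            · exact mem_image.2 ⟨s.1, mem_inter.2 ⟨hwT, mem_of_mem_erase s.2⟩, by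
                rw [dif_pos s.2]⟩
            · exact absurd (mem_singleton.1 hw ▸ hwT) hvT
      have h2 := card_le_card h1
      have h3 := card_union_le (T \ S)
        ((T ∩ S).image (fun s => if hs : s ∈ S.erase x then φ ⟨s, hs⟩ else s))
      have h4 : ((T ∩ S).image (fun s => if hs : s ∈ S.erase x then φ ⟨s, hs⟩ else s)).card
        ≤ (T ∩ S).card := card_image_le
      have h5 := card_sdiff_add_card_inter T S
      omega)
    have hfS : ∀ v ∈ f, v ∉ S := by
      intro v hv hvS
      obtain ⟨w, hw, hwn⟩ := hother f hf v hv hvS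
      exact hfT w hw (mem_union_right _ hwn)
    obtain ⟨v, hv, hvT⟩ := hT2 f hf (by rintro rfl; exact hfS x (by simp) hx)
    exact hfT v hv (mem_union_left _ (mem_sdiff.2 ⟨hvT, hfS v hv⟩))

theorem two_bound {b : ℕ} {F : Finset (Finset V)} (h : Crit 2 b F) :
    Fintype.card V ≤ 2 * b + 2 := by
  classical
  obtain ⟨e, he, _⟩ := h.tau ∅ (by simp)
  obtain ⟨x, hx⟩ : e.Nonempty := by rw [← card_pos, h.card e he]; omega
  obtain ⟨T, hT, hT2⟩ := h.crit e he
  have hS : ∀ f ∈ F, ¬ f ⊆ (insert x T)ᶜ := by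
    intro f hf hc
    by_cases hfe : f = e
    · subst hfe; have := hc hx; simp at this
    · obtain ⟨v, hv, hvT⟩ := hT2 f hf hfe
      have := hc hv
      simp [hvT] at this
  have h1 := hajnal h _ hS
  have h2 : nb F (insert x T)ᶜ ⊆ insert x T := by
    intro r hr
    by_contra hc
    exact nb_disj hS hr (mem_compl.2 hc)
  have h3 := card_le_card h2
  have h4 := card_insert_le x T
  have h5 := card_add_card_compl (insert x T)
  omega
end Tuza

namespace Tuza
set_option linter.unusedSectionVars false
variable {V : Type*} [Fintype V] [DecidableEq V]

/-- Systems of edges with small pairwise intersections and an elimination order. -/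
structure SS (k : ℕ) (F : Finset (Finset V)) {m : ℕ} (e : Fin m → Finset V) : Prop where
  mem : ∀ i, e i ∈ F
  int : ∀ i j, i ≠ j → (e i ∩ e j).card + 2 ≤ k
  ord : ∀ i, ∃ x ∈ e i, ∀ j < i, x ∉ e j

def cov {m : ℕ} (e : Fin m → Finset V) : Finset V := univ.biUnion e

theorem mem_cov {m : ℕ} {e : Fin m → Finset V} {v : V} : v ∈ cov e ↔ ∃ i, v ∈ e i := by
  simp [cov]

def Priv {m : ℕ} (e : Fin m → Finset V) (j : Fin m) (v : V) : Prop :=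
  v ∈ e j ∧ ∀ i, i ≠ j → v ∉ e i

/-- swap data -/
structure Sw (F : Finset (Finset V)) {m : ℕ} (e : Fin m → Finset V) (j : Fin m) (f : Finset V)
    (z w : V) : Prop where
  hf : f ∈ F
  hz : ∀ i, z ∉ e i
  hzf : z ∈ f
  hw : w ∈ e j
  heq : f.erase z = (e j).erase w

def Abs (F : Finset (Finset V)) {m : ℕ} (e : Fin m → Finset V) (z : V) : Prop :=
  (∀ i, z ∉ e i) ∧ ∃ f j w, Sw F e j f z w ∧ ∃ u ∈ f, ∃ u' ∈ f, u ≠ u' ∧ Priv e j u ∧ Priv e j u'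

open Classical in
noncomputable def absSet (F : Finset (Finset V)) {m : ℕ} (e : Fin m → Finset V) : Finset V :=
  univ.filter (Abs F e)

theorem mem_absSet {F : Finset (Finset V)} {m : ℕ} {e : Fin m → Finset V} {z : V} :
    z ∈ absSet F e ↔ Abs F e z := by simp [absSet]

def CovMax (k : ℕ) (F : Finset (Finset V)) (c : ℕ) : Prop :=
  ∀ (m : ℕ) (e : Fin m → Finset V), SS k F e → (cov e).card ≤ c

structure Opt (k : ℕ) (F : Finset (Finset V)) {m : ℕ} (e : Fin m → Finset V) : Prop where
  ss : SS k F e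
  mx : CovMax k F (cov e).card
  ab : ∀ (m' : ℕ) (e' : Fin m' → Finset V), SS k F e' → (cov e').card = (cov e).card →
    (absSet F e').card ≤ (absSet F e).card

theorem exists_opt (k : ℕ) (F : Finset (Finset V)) :
    ∃ (m : ℕ) (e : Fin m → Finset V), Opt k F e := by
  classical
  let N := Fintype.card V
  let P : ℕ → Prop := fun v => ∃ (m : ℕ) (e : Fin m → Finset V), SS k F e ∧
    (N + 1) * (cov e).card + (absSet F e).card = v
  have h0 : P ((N + 1) * (cov (Fin.elim0 : Fin 0 → Finset V)).card +
      (absSet F (Fin.elim0 : Fin 0 → Finset V)).card) :=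
    ⟨0, _, ⟨fun i => i.elim0, fun i => i.elim0, fun i => i.elim0⟩, rfl⟩
  have hN : ∀ (m : ℕ) (e : Fin m → Finset V), (cov e).card ≤ N ∧ (absSet F e).card ≤ N :=
    fun m e => ⟨card_le_univ _, card_le_univ _⟩
  have hb : ∀ v, P v → v ≤ (N + 1) * N + N := by
    rintro v ⟨m, e, _, rfl⟩
    have := hN m e
    exact add_le_add (Nat.mul_le_mul_left _ this.1) this.2
  obtain ⟨m, e, hs, he⟩ := Nat.findGreatest_spec (P := P) (hb _ h0) h0
  have hmax : ∀ v, P v → v ≤ (N + 1) * (cov e).card + (absSet F e).card := by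
    intro v hv
    rw [he]
    exact Nat.le_findGreatest (hb v hv) hv
  refine ⟨m, e, hs, ?_, ?_⟩
  · intro m' e' hs'
    have h1 := hmax _ ⟨m', e', hs', rfl⟩
    have h2 := hN m e
    by_contra hlt
    push Not at hlt
    have := Nat.mul_le_mul_left (N + 1) (Nat.succ_le_of_lt hlt)
    rw [Nat.mul_succ] at this
    omega
  · intro m' e' hs' hc
    have h1 := hmax _ ⟨m', e', hs', rfl⟩
    rw [hc] at h1
    omega

section
variable {k b : ℕ} {F : Finset (Finset V)} {m : ℕ} {e : Fin m → Finset V}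

theorem append_sub (hF : ∀ f ∈ F, f.card = k) (hs : SS k F e) (hm : CovMax k F (cov e).card)
    {z : V} (hz : ∀ i, z ∉ e i) {f : Finset V} (hf : f ∈ F) (hzf : z ∈ f) :
    ∃ j, f.erase z ⊆ e j := by
  classical
  by_contra hcon
  push Not at hcon
  have hint : ∀ j, (f ∩ e j).card + 2 ≤ k := by
    intro j
    obtain ⟨v, hv, hvj⟩ := not_subset.1 (hcon j)
    have h1 : f ∩ e j ⊆ (f.erase z).erase v := by
      intro y hy
      obtain ⟨hy1, hy2⟩ := mem_inter.1 hy
      refine mem_erase.2 ⟨?_, mem_erase.2 ⟨?_, hy1⟩⟩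
      · rintro rfl; exact hvj hy2
      · rintro rfl; exact hz j hy2
    have h2 := card_le_card h1
    have h3 := card_erase_add_one hv
    have h4 := card_erase_add_one hzf
    have := hF f hf
    omega
  let e' : Fin (m + 1) → Finset V := Fin.snoc (α := fun _ => Finset V) e f
  have hl : e' (Fin.last m) = f := by simp [e']
  have hc : ∀ i : Fin m, e' i.castSucc = e i := by intro i; simp [e']
  have hs' : SS k F e' := by
    refine ⟨?_, ?_, ?_⟩
    · intro i
      refine Fin.lastCases ?_ (fun i => ?_) i
      · rw [hl]; exact hf
      · rw [hc]; exact hs.mem i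
    · intro i j
      refine Fin.lastCases ?_ (fun i => ?_) i
      · refine Fin.lastCases (fun hne => absurd rfl hne) (fun j _ => ?_) j
        rw [hl, hc]; exact hint j
      · refine Fin.lastCases (fun _ => ?_) (fun j hne => ?_) j
        · rw [hl, hc, inter_comm]; exact hint i
        · rw [hc, hc]; exact hs.int i j (fun h => hne (by rw [h]))
    · intro i
      refine Fin.lastCases ?_ (fun i => ?_) i
      · refine ⟨z, by rw [hl]; exact hzf, fun j => ?_⟩
        refine Fin.lastCases (fun hlt => absurd hlt (lt_irrefl _)) (fun j _ => ?_) j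
        rw [hc]; exact hz j
      · obtain ⟨x, hx, hxj⟩ := hs.ord i
        refine ⟨x, by rw [hc]; exact hx, fun j => ?_⟩
        refine Fin.lastCases (fun hlt => ?_) (fun j hlt => ?_) j
        · exact absurd hlt (not_lt.2 (Fin.le_last _))
        · rw [hc]; exact hxj j (by simpa using hlt)
  have h1 := hm _ e' hs'
  have h2 : insert z (cov e) ⊆ cov e' := by
    intro v hv
    rcases mem_insert.1 hv with rfl | hv
    · exact mem_cov.2 ⟨Fin.last m, by rw [hl]; exact hzf⟩
    · obtain ⟨i, hi⟩ := mem_cov.1 hv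
      exact mem_cov.2 ⟨i.castSucc, by rw [hc]; exact hi⟩
  have h3 := card_le_card h2
  rw [card_insert_of_notMem (by rw [mem_cov]; push Not; exact hz)] at h3
  omega

theorem sw_of_sub (hF : ∀ f ∈ F, f.card = k) (hs : SS k F e) 
    {z : V} (hz : ∀ i, z ∉ e i) {f : Finset V} (hf : f ∈ F) (hzf : z ∈ f) {j : Fin m}
    (hj : f.erase z ⊆ e j) : ∃ w, Sw F e j f z w := by
  classical
  have h1 : (e j \ f.erase z).card = 1 := by
    rw [card_sdiff_of_subset hj, card_erase_of_mem hzf, hF f hf, hF _ (hs.mem j)]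
    have : 0 < f.card := card_pos.2 ⟨z, hzf⟩
    rw [hF f hf] at this
    omega
  obtain ⟨w, hw⟩ := card_eq_one.1 h1
  have hw' : w ∈ e j \ f.erase z := by rw [hw]; simp
  refine ⟨w, hf, hz, hzf, (mem_sdiff.1 hw').1, ?_⟩
  ext v
  constructor
  · intro hv
    exact mem_erase.2 ⟨fun hc => (mem_sdiff.1 hw').2 (hc ▸ hv), hj hv⟩
  · intro hv
    by_contra hc
    have : v ∈ e j \ f.erase z := mem_sdiff.2 ⟨mem_of_mem_erase hv, hc⟩
    rw [hw] at this
    exact ne_of_mem_erase hv (mem_singleton.1 this)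

theorem sw_exists (hF : ∀ f ∈ F, f.card = k) (hs : SS k F e) (hm : CovMax k F (cov e).card)
    {z : V} (hz : ∀ i, z ∉ e i) {f : Finset V} (hf : f ∈ F) (hzf : z ∈ f) :
    ∃ j w, Sw F e j f z w := by
  obtain ⟨j, hj⟩ := append_sub hF hs hm hz hf hzf
  obtain ⟨w, hw⟩ := sw_of_sub hF hs hz hf hzf hj
  exact ⟨j, w, hw⟩

variable {j : Fin m} {f : Finset V} {z w : V}

theorem Sw.mem (h : Sw F e j f z w) {v : V} : v ∈ f ↔ v = z ∨ (v ∈ e j ∧ v ≠ w) := by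
  have : f = insert z ((e j).erase w) := by rw [← h.heq, insert_erase h.hzf]
  rw [this]; simp [and_comm]

theorem Sw.wz (h : Sw F e j f z w) : w ≠ z := by
  rintro rfl; exact h.hz _ h.hw

theorem Sw.wf (h : Sw F e j f z w) : w ∉ f := by
  rw [h.mem]; rintro (hc | hc)
  · exact h.wz hc
  · exact hc.2 rfl

theorem Sw.ss (h : Sw F e j f z w) (hs : SS k F e) : SS k F (Function.update e j f) := by
  have hint : ∀ i, i ≠ j → (f ∩ e i).card + 2 ≤ k := by
    intro i hi
    have h1 : f ∩ e i ⊆ e j ∩ e i := by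
      intro v hv
      obtain ⟨hv1, hv2⟩ := mem_inter.1 hv
      rcases h.mem.1 hv1 with rfl | hv1
      · exact absurd hv2 (h.hz i)
      · exact mem_inter.2 ⟨hv1.1, hv2⟩
    have := card_le_card h1
    have := hs.int j i hi.symm
    omega
  refine ⟨?_, ?_, ?_⟩
  · intro i
    by_cases hi : i = j
    · subst hi; rw [Function.update_self]; exact h.hf
    · rw [Function.update_of_ne hi]; exact hs.mem i
  · intro i i' hne
    by_cases hi : i = j
    · subst hi; rw [Function.update_self, Function.update_of_ne hne.symm]; exact hint i' hne.symm
    · rw [Function.update_of_ne hi]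
      by_cases hi' : i' = j
      · subst hi'; rw [Function.update_self, inter_comm]; exact hint i hi
      · rw [Function.update_of_ne hi']; exact hs.int i i' hne
  · intro i
    by_cases hi : i = j
    · subst hi; rw [Function.update_self]
      refine ⟨z, h.hzf, fun i' hi' => ?_⟩
      rw [Function.update_of_ne hi'.ne]; exact h.hz i'
    · rw [Function.update_of_ne hi]
      obtain ⟨x, hx, hxj⟩ := hs.ord i
      refine ⟨x, hx, fun i' hi' => ?_⟩
      by_cases hi'' : i' = j
      · subst hi''; rw [Function.update_self, h.mem]
        rintro (rfl | hc)
        · exact h.hz i hx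
        · exact hxj _ hi' hc.1
      · rw [Function.update_of_ne hi'']; exact hxj _ hi'

theorem Sw.priv (h : Sw F e j f z w) (hs : SS k F e) (hm : CovMax k F (cov e).card) :
    ∀ i, i ≠ j → w ∉ e i := by
  intro i hi hc
  have h1 := hm _ _ (h.ss hs)
  have h2 : insert z (cov e) ⊆ cov (Function.update e j f) := by
    intro v hv
    rcases mem_insert.1 hv with rfl | hv
    · exact mem_cov.2 ⟨j, by rw [Function.update_self]; exact h.hzf⟩
    · obtain ⟨i', hi'⟩ := mem_cov.1 hv
      by_cases hij : i' = j
      · subst hij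
        by_cases hvw : v = w
        · subst hvw; exact mem_cov.2 ⟨i, by rw [Function.update_of_ne hi]; exact hc⟩
        · exact mem_cov.2 ⟨i', by rw [Function.update_self, h.mem]; exact Or.inr ⟨hi', hvw⟩⟩
      · exact mem_cov.2 ⟨i', by rw [Function.update_of_ne hij]; exact hi'⟩
  have h3 := card_le_card h2
  rw [card_insert_of_notMem (by rw [mem_cov]; push Not; exact h.hz)] at h3
  omega

theorem Sw.token (h : Sw F e j f z w) (hs : SS k F e) (hm : CovMax k F (cov e).card) :
    ∀ i, w ∉ Function.update e j f i := by
  intro i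
  by_cases hi : i = j
  · subst hi; rw [Function.update_self]; exact h.wf
  · rw [Function.update_of_ne hi]; exact h.priv hs hm i hi

theorem Sw.covcard (h : Sw F e j f z w) (hs : SS k F e) (hm : CovMax k F (cov e).card) :
    (cov (Function.update e j f)).card = (cov e).card := by
  apply le_antisymm (hm _ _ (h.ss hs))
  have h2 : insert z ((cov e).erase w) ⊆ cov (Function.update e j f) := by
    intro v hv
    rcases mem_insert.1 hv with rfl | hv
    · exact mem_cov.2 ⟨j, by rw [Function.update_self]; exact h.hzf⟩
    · obtain ⟨hvw, hv⟩ := mem_erase.1 hv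
      obtain ⟨i', hi'⟩ := mem_cov.1 hv
      by_cases hij : i' = j
      · subst hij
        exact mem_cov.2 ⟨i', by rw [Function.update_self, h.mem]; exact Or.inr ⟨hi', hvw⟩⟩
      · exact mem_cov.2 ⟨i', by rw [Function.update_of_ne hij]; exact hi'⟩
  have h3 := card_le_card h2
  rw [card_insert_of_notMem, card_erase_add_one (mem_cov.2 ⟨j, h.hw⟩)] at h3
  · exact h3
  · intro hc
    obtain ⟨i, hi⟩ := mem_cov.1 (mem_of_mem_erase hc)
    exact h.hz i hi

theorem Sw.same (hF : ∀ f ∈ F, f.card = k) {f' : Finset V} {z' w' : V} (h : Sw F e j f z w)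
    (h' : Sw F e j f' z' w') (hs : SS k F e) (hm : CovMax k F (cov e).card) (hne : z ≠ z') :
    w = w' := by
  have hs' := h.ss hs
  have hm' : CovMax k F (cov (Function.update e j f)).card := by rw [h.covcard hs hm]; exact hm
  have ht : ∀ i, z' ∉ Function.update e j f i := by
    intro i
    by_cases hi : i = j
    · subst hi; rw [Function.update_self, h.mem]
      rintro (hc | hc)
      · exact hne hc.symm
      · exact h'.hz _ hc.1
    · rw [Function.update_of_ne hi]; exact h'.hz i
  obtain ⟨i, hi⟩ := append_sub hF hs' hm' ht h'.hf h'.hzf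
  by_contra hww
  by_cases hij : i = j
  · subst hij
    rw [Function.update_self] at hi
    exact h.wf (hi (h'.heq ▸ mem_erase.2 ⟨hww, h.hw⟩))
  · rw [Function.update_of_ne hij] at hi
    have h1 : (e j).erase w' ⊆ e j ∩ e i := by
      intro v hv
      exact mem_inter.2 ⟨mem_of_mem_erase hv, hi (h'.heq ▸ hv)⟩
    have h2 := card_le_card h1
    have h3 := card_erase_add_one h'.hw
    have h4 := hF _ (hs.mem j)
    have h5 := hs.int j i (fun hc => hij hc.symm)
    omega

theorem Sw.opt (hF : ∀ f ∈ F, f.card = k) (h : Sw F e j f z w) (ho : Opt k F e)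
    (hb : ¬ Abs F e z) : Opt k F (Function.update e j f) ∧ ¬ Abs F (Function.update e j f) w := by
  have hs' := h.ss ho.ss
  have hc := h.covcard ho.ss ho.mx
  have hsub : absSet F e ⊆ absSet F (Function.update e j f) := by
    intro y hy
    rw [mem_absSet] at hy ⊢
    have hyz : y ≠ z := by rintro rfl; exact hb hy
    obtain ⟨hyt, f', i, w', hsw, u, hu, u', hu', hne, hp, hp'⟩ := hy
    have hij : i ≠ j := by
      rintro rfl
      have hww := h.same hF hsw ho.ss ho.mx hyz.symm
      subst hww
      have hin : ∀ v ∈ f', Priv e i v → v ∈ f := by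
        intro v hv hpv
        rcases hsw.mem.1 hv with rfl | hv
        · exact absurd hpv.1 (hyt i)
        · exact h.mem.2 (Or.inr hv)
      exact hb ⟨h.hz, f, i, w, h, u, hin u hu hp, u', hin u' hu' hp', hne, hp, hp'⟩
    have hpr : ∀ v, Priv e i v → Priv (Function.update e j f) i v := by
      intro v hv
      refine ⟨by rw [Function.update_of_ne hij]; exact hv.1, fun i' hi' => ?_⟩
      by_cases hij' : i' = j
      · subst hij'
        rw [Function.update_self, h.mem]
        rintro (rfl | hc)
        · exact h.hz _ hv.1
        · exact hv.2 _ hi' hc.1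
      · rw [Function.update_of_ne hij']; exact hv.2 _ hi'
    have hyt' : ∀ i, y ∉ Function.update e j f i := by
      intro i'
      by_cases hij' : i' = j
      · subst hij'
        rw [Function.update_self, h.mem]
        rintro (hc | hc)
        · exact hyz hc
        · exact hyt _ hc.1
      · rw [Function.update_of_ne hij']; exact hyt _
    refine ⟨hyt', f', i, w', ⟨hsw.hf, hyt', hsw.hzf, ?_, ?_⟩, u, hu, u', hu', hne, hpr u hp, hpr u' hp'⟩
    · rw [Function.update_of_ne hij]; exact hsw.hw
    · rw [Function.update_of_ne hij]; exact hsw.heq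
  have hle := ho.ab _ _ hs' hc
  have heq := eq_of_subset_of_card_le hsub hle
  refine ⟨⟨hs', by rw [hc]; exact ho.mx, fun m' e' h1 h2 => ?_⟩, ?_⟩
  · rw [← heq]; exact ho.ab m' e' h1 (h2.trans hc)
  · rw [← mem_absSet, ← heq, mem_absSet]
    intro hA
    exact hA.1 j h.hw

inductive Reach (F : Finset (Finset V)) {m : ℕ} (e0 : Fin m → Finset V) :
    (Fin m → Finset V) → Prop
  | refl : Reach F e0 e0
  | step {e : Fin m → Finset V} {j f z w} : Reach F e0 e → ¬ Abs F e z → Sw F e j f z w →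
      Reach F e0 (Function.update e j f)

variable {e0 : Fin m → Finset V}

theorem Reach.opt (hF : ∀ f ∈ F, f.card = k) (ho : Opt k F e0) (hr : Reach F e0 e) :
    Opt k F e := by
  induction hr with
  | refl => exact ho
  | step _ hb hsw ih => exact (hsw.opt hF ih hb).1

def Dd (F : Finset (Finset V)) {m : ℕ} (e0 : Fin m → Finset V) (d : V) : Prop :=
  ∃ e, Reach F e0 e ∧ (∀ i, d ∉ e i) ∧ ¬ Abs F e d

theorem Reach.dw (hF : ∀ f ∈ F, f.card = k) (ho : Opt k F e0) (hr : Reach F e0 e)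
    (hb : ¬ Abs F e z) (h : Sw F e j f z w) : Dd F e0 w :=
  have hoe := hr.opt hF ho
  ⟨_, hr.step hb h, h.token hoe.ss hoe.mx, (h.opt hF hoe hb).2⟩

theorem Reach.inv1 (hF : ∀ f ∈ F, f.card = k) (ho : Opt k F e0) (hr : Reach F e0 e) (i : Fin m)
    {v : V} (hv : v ∈ e0 i) (hd : ¬ Dd F e0 v) : v ∈ e i := by
  induction hr with
  | refl => exact hv
  | @step e j f z w hr hb hsw ih =>
    by_cases hi : i = j
    · subst hi
      rw [Function.update_self, hsw.mem]
      right
      refine ⟨ih, ?_⟩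
      rintro rfl
      exact hd (hr.dw hF ho hb hsw)
    · rw [Function.update_of_ne hi]; exact ih

theorem Reach.inv2 (hF : ∀ f ∈ F, f.card = k) (ho : Opt k F e0) (hr : Reach F e0 e) (i i' : Fin m)
    (hne : i ≠ i') {v : V} : (v ∈ e i ∧ v ∈ e i') ↔ (v ∈ e0 i ∧ v ∈ e0 i') := by
  induction hr with
  | refl => rfl
  | @step e j f z w hr hb hsw ih =>
    rw [← ih]
    have hoe := hr.opt hF ho
    have key : ∀ l, l ≠ j → ((v ∈ f ∧ v ∈ e l) ↔ (v ∈ e j ∧ v ∈ e l)) := by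
      intro l hl
      rw [hsw.mem]
      constructor
      · rintro ⟨rfl | h1, h2⟩
        · exact absurd h2 (hsw.hz l)
        · exact ⟨h1.1, h2⟩
      · rintro ⟨h1, h2⟩
        refine ⟨Or.inr ⟨h1, ?_⟩, h2⟩
        rintro rfl
        exact hsw.priv hoe.ss hoe.mx l hl h2
    by_cases hi : i = j
    · subst hi
      rw [Function.update_self, Function.update_of_ne hne.symm]
      exact key i' hne.symm
    · rw [Function.update_of_ne hi]
      by_cases hi' : i' = j
      · subst hi'
        rw [Function.update_self, and_comm, key i hi, and_comm]
      · rw [Function.update_of_ne hi']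

def Touched (F : Finset (Finset V)) {m : ℕ} (e0 : Fin m → Finset V) (j : Fin m) : Prop :=
  ∃ e f z w, Reach F e0 e ∧ ¬ Abs F e z ∧ Sw F e j f z w

theorem touched_c (hk : 3 ≤ k) (hF : ∀ f ∈ F, f.card = k) (ho : Opt k F e0)
    (ht : Touched F e0 j) :
    ∃ c, ∀ e f z w, Reach F e0 e → ¬ Abs F e z → Sw F e j f z w → c ∈ f := by
  obtain ⟨e, f, z, w, hr, hb, hsw⟩ := ht
  have hcard : 1 < (f.erase z).card := by
    rw [card_erase_of_mem hsw.hzf, hF f hsw.hf]; omega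
  obtain ⟨a, ha, a', ha', hne⟩ := one_lt_card.1 hcard
  have hmem : ∀ v ∈ f.erase z, v ∈ e j := fun v hv => mem_of_mem_erase (hsw.heq ▸ hv)
  have : ∃ c i, i ≠ j ∧ c ∈ e j ∧ c ∈ e i := by
    by_contra hcon
    push Not at hcon
    exact hb ⟨hsw.hz, f, j, w, hsw, a, mem_of_mem_erase ha, a', mem_of_mem_erase ha', hne,
      ⟨hmem a ha, fun i hi => hcon a i hi (hmem a ha)⟩,
      ⟨hmem a' ha', fun i hi => hcon a' i hi (hmem a' ha')⟩⟩
  obtain ⟨c, i, hi, hcj, hci⟩ := this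
  have hc0 := (hr.inv2 hF ho j i hi.symm).1 ⟨hcj, hci⟩
  refine ⟨c, fun e' f' z' w' hr' hb' hsw' => ?_⟩
  have hc' := (hr'.inv2 hF ho j i hi.symm).2 hc0
  have ho' := hr'.opt hF ho
  refine hsw'.mem.2 (Or.inr ⟨hc'.1, ?_⟩)
  rintro rfl
  exact hsw'.priv ho'.ss ho'.mx i hi hc'.2

theorem all_abs (hk : 3 ≤ k) (hC : Crit k b F) (ho : Opt k F e0) (hz : ∀ i, z ∉ e0 i) :
    Abs F e0 z := by
  classical
  by_contra hb
  have hF := hC.card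
  obtain ⟨g, hg, hzg⟩ := hC.cov z
  obtain ⟨T, hT, hT2⟩ := hC.crit g hg
  have hDz : Dd F e0 z := ⟨e0, .refl, hz, hb⟩
  have hc : ∀ j, ∃ c, Touched F e0 j →
      ∀ e f z w, Reach F e0 e → ¬ Abs F e z → Sw F e j f z w → c ∈ f := by
    intro j
    by_cases ht : Touched F e0 j
    · obtain ⟨c, hc⟩ := touched_c hk hF ho ht; exact ⟨c, fun _ => hc⟩
    · exact ⟨z, fun h => absurd h ht⟩
  choose c hc using hc
  let J : Finset (Fin m) := univ.filter fun j => Touched F e0 j ∧ ∀ v ∈ T, v ∈ e0 j → Dd F e0 v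
  have hTj : ∀ j, ∃ v ∈ e0 j, v ∈ T := fun j =>
    hT2 _ (ho.ss.mem j) (fun hc => hz j (hc ▸ hzg))
  choose y hy hyT using hTj
  have hJ : J.card ≤ (T.filter (Dd F e0)).card := by
    apply card_le_card_of_injOn y
    · intro j hj
      have hj := (mem_filter.1 hj).2
      exact mem_coe.2 (mem_filter.2 ⟨hyT j, hj.2 _ (hyT j) (hy j)⟩)
    · intro i hi i' hi' hyy
      by_contra hne
      have hi := (mem_filter.1 hi).2
      obtain ⟨e, hr, het, _⟩ := hi.2 _ (hyT i) (hy i)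
      exact het i ((hr.inv2 hF ho i i' hne).2 ⟨hy i, hyy ▸ hy i'⟩).1
  obtain ⟨f, hf, hfT⟩ := hC.tau (T.filter (fun v => ¬ Dd F e0 v) ∪ J.image c) (by
    have h1 := card_union_le (T.filter (fun v => ¬ Dd F e0 v)) (J.image c)
    have h2 : (J.image c).card ≤ J.card := card_image_le
    have h3 := card_filter_add_card_filter_not (s := T) (Dd F e0)
    omega)
  by_cases hd : ∃ d ∈ f, Dd F e0 d
  · obtain ⟨d, hdf, e, hr, hde, hdb⟩ := hd
    have hoe := hr.opt hF ho
    obtain ⟨j, w, hsw⟩ := sw_exists hF hoe.ss hoe.mx hde hf hdf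
    have ht : Touched F e0 j := ⟨e, f, d, w, hr, hdb, hsw⟩
    by_cases hjJ : j ∈ J
    · exact hfT _ (hc j ht e f d w hr hdb hsw) (mem_union_right _ (mem_image_of_mem _ hjJ))
    · have : ∃ v ∈ T, v ∈ e0 j ∧ ¬ Dd F e0 v := by
        by_contra hcon
        push Not at hcon
        exact hjJ (mem_filter.2 ⟨mem_univ _, ht, hcon⟩)
      obtain ⟨v, hvT, hvj, hvD⟩ := this
      have hvw : v ≠ w := by rintro rfl; exact hvD (hr.dw hF ho hdb hsw)
      exact hfT v (hsw.mem.2 (Or.inr ⟨hr.inv1 hF ho j hvj hvD, hvw⟩))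
        (mem_union_left _ (mem_filter.2 ⟨hvT, hvD⟩))
  · push Not at hd
    obtain ⟨v, hv, hvT⟩ := hT2 f hf (by rintro rfl; exact hd z hzg hDz)
    exact hfT v hv (mem_union_left _ (mem_filter.2 ⟨hvT, hd v hv⟩))

end
end Tuza

namespace Tuza
set_option linter.unusedSectionVars false
variable {V : Type*} [Fintype V] [DecidableEq V]

theorem good_cover {k b : ℕ} {F : Finset (Finset V)} (hk : 3 ≤ k) (hC : Crit k b F) :
    ∃ 𝒢 ⊆ F, 𝒢.biUnion id = univ ∧ 𝒢.card ≤ (k + b - 1).choose b := by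
  classical
  obtain ⟨m, e, ho⟩ := exists_opt k F
  have hF := hC.card
  have habs : ∀ z : V, ∃ (f : Finset V) (d : Option (Fin m × V × V × V)), (∀ i, z ∉ e i) →
      ∃ j w u u', d = some (j, w, u, u') ∧ Sw F e j f z w ∧ u ∈ f ∧ u' ∈ f ∧ u ≠ u' ∧
        Priv e j u ∧ Priv e j u' := by
    intro z
    by_cases hz : ∀ i, z ∉ e i
    · obtain ⟨_, f, j, w, h1, u, h2, u', h3, h4, h5, h6⟩ := all_abs hk hC ho hz
      exact ⟨f, some (j, w, u, u'), fun _ => ⟨j, w, u, u', rfl, h1, h2, h3, h4, h5, h6⟩⟩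
    · exact ⟨∅, none, fun h => absurd h hz⟩
  choose f d hfd using habs
  -- the absorbing relation
  let At : V → Fin m → Prop := fun z j => (∀ i, z ∉ e i) ∧ ∃ w, Sw F e j (f z) z w
  have hAt : ∀ z, (∀ i, z ∉ e i) → ∃ j, At z j := by
    intro z hz
    obtain ⟨j, w, u, u', _, h, _⟩ := hfd z hz
    exact ⟨j, hz, w, h⟩
  have hAtu : ∀ z j j', At z j → At z j' → j = j' := by
    rintro z j j' ⟨_, w, h⟩ ⟨_, w', h'⟩
    by_contra hne
    have h1 : (f z).erase z ⊆ e j ∩ e j' := by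
      intro v hv
      exact mem_inter.2 ⟨mem_of_mem_erase (h.heq ▸ hv), mem_of_mem_erase (h'.heq ▸ hv)⟩
    have h2 := card_le_card h1
    have h3 := card_erase_add_one h.hzf
    have h4 := hF _ h.hf
    have h5 := ho.ss.int j j' hne
    omega
  let Ab : Fin m → Prop := fun j => ∃ z, At z j
  have hu : ∀ j, ∃ u u', Ab j → u ≠ u' ∧ Priv e j u ∧ Priv e j u' ∧
      ∀ z, At z j → u ∈ f z ∧ u' ∈ f z := by
    intro j
    by_cases hj : Ab j
    · obtain ⟨z, hz⟩ := hj
      obtain ⟨i, w, u, u', _, hsw, h2, h3, h4, h5, h6⟩ := hfd z hz.1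
      obtain rfl := hAtu z i j ⟨hz.1, w, hsw⟩ hz
      refine ⟨u, u', fun _ => ⟨h4, h5, h6, fun z' hz' => ?_⟩⟩
      by_cases hzz : z = z'
      · subst hzz; exact ⟨h2, h3⟩
      · obtain ⟨hz't, w', hsw'⟩ := hz'
        obtain rfl := hsw.same hF hsw' ho.ss ho.mx hzz
        have hin : ∀ v ∈ f z, Priv e i v → v ∈ f z' := by
          intro v hv hpv
          rcases hsw.mem.1 hv with rfl | hv
          · exact absurd hpv.1 (hsw.hz i)
          · exact hsw'.mem.2 (Or.inr hv)
        exact ⟨hin u h2 h5, hin u' h3 h6⟩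
    · obtain ⟨x, _⟩ := ho.ss.ord j
      exact ⟨x, x, fun h => absurd h hj⟩
  choose u u' hu using hu
  have hπ : ∀ v, ∃ y, (∃ j, Ab j ∧ v = u' j ∧ y = u j) ∨ ((∀ j, Ab j → v ≠ u' j) ∧ y = v) := by
    intro v
    by_cases h : ∃ j, Ab j ∧ v = u' j
    · obtain ⟨j, h1, h2⟩ := h; exact ⟨u j, Or.inl ⟨j, h1, h2, rfl⟩⟩
    · push Not at h; exact ⟨v, Or.inr ⟨h, rfl⟩⟩
  choose π hπ using hπ
  have hπne : ∀ v j, Ab j → π v ≠ u' j := by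
    intro v j hj hc
    rcases hπ v with ⟨i, hi, _, hy⟩ | ⟨h1, hy⟩
    · by_cases hij : i = j
      · subst hij; exact (hu i hi).1 (hy.symm.trans hc)
      · exact (hu j hj).2.2.1.2 i hij ((hy.symm.trans hc) ▸ (hu i hi).2.1.1)
    · exact h1 j hj (hy.symm.trans hc)
  let 𝒢 : Finset (Finset V) := univ.image e ∪ (univ.filter fun z => ∀ i, z ∉ e i).image f
  have h𝒢 : ∀ g ∈ 𝒢, (∃ i, g = e i) ∨ ∃ z i, At z i ∧ g = f z := by
    intro g hg
    rcases mem_union.1 hg with hg | hg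
    · obtain ⟨i, _, rfl⟩ := mem_image.1 hg; exact Or.inl ⟨i, rfl⟩
    · obtain ⟨z, hz, rfl⟩ := mem_image.1 hg
      obtain ⟨i, hi⟩ := hAt z (mem_filter.1 hz).2
      exact Or.inr ⟨z, i, hi, rfl⟩
  have h𝒢F : 𝒢 ⊆ F := by
    intro g hg
    rcases h𝒢 g hg with ⟨i, rfl⟩ | ⟨z, i, ⟨_, w, h⟩, rfl⟩
    · exact ho.ss.mem i
    · exact h.hf
  have hcov : 𝒢.biUnion id = univ := by
    rw [eq_univ_iff_forall]
    intro v
    rw [mem_biUnion]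
    by_cases hv : ∀ i, v ∉ e i
    · obtain ⟨i, _, w, h⟩ := hAt v hv
      exact ⟨f v, mem_union_right _ (mem_image.2 ⟨v, mem_filter.2 ⟨mem_univ _, hv⟩, rfl⟩), h.hzf⟩
    · push Not at hv
      obtain ⟨i, hi⟩ := hv
      exact ⟨e i, mem_union_left _ (mem_image_of_mem _ (mem_univ _)), hi⟩
  have hpair : ∀ g ∈ 𝒢, ∀ j, Ab j → (u' j ∈ g ↔ u j ∈ g) := by
    intro g hg j hj
    obtain ⟨_, hp, hp', hz⟩ := hu j hj
    rcases h𝒢 g hg with ⟨i, rfl⟩ | ⟨z, i, hzi, rfl⟩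
    · by_cases hij : i = j
      · subst hij; exact iff_of_true hp'.1 hp.1
      · exact iff_of_false (hp'.2 i hij) (hp.2 i hij)
    · by_cases hij : i = j
      · subst hij; exact iff_of_true (hz z hzi).2 (hz z hzi).1
      · obtain ⟨hzt, w, hsw⟩ := hzi
        have hn : ∀ v, Priv e j v → v ∉ f z := by
          intro v hv hc
          rcases hsw.mem.1 hc with rfl | hc
          · exact hzt j hv.1
          · exact hv.2 i hij hc.1
        exact iff_of_false (hn _ hp') (hn _ hp)
  have hπg : ∀ g ∈ 𝒢, ∀ v, v ∈ g ↔ π v ∈ g := by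
    intro g hg v
    rcases hπ v with ⟨i, hi, hv, hy⟩ | ⟨h1, hy⟩
    · rw [hy, hv]; exact hpair g hg i hi
    · rw [hy]
  have hek : ∀ i, (e i).card = k := fun i => hF _ (ho.ss.mem i)
  obtain ⟨p, hp1, hp2⟩ := realize k e hek ho.ss.int ho.ss.ord (univ.filter fun i => ¬ Ab i)
  -- generic argument at absorbing positions
  have habsorb : ∀ g : Finset V, g.card = k → ∀ j, Ab j → u j ∈ g → u' j ∈ g →
      ∃ h : Fin k → ℚ, (∀ v ∈ g, (∀ j, Ab j → v ≠ u' j) → p v ⬝ᵥ h = 0) ∧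
        ∀ v, v ∉ g → p v ⬝ᵥ h ≠ 0 := by
    intro g hgk j hj hug hug'
    have hG : (g.erase (u' j)).card + 1 = k := by rw [card_erase_add_one hug', hgk]
    obtain ⟨h, h0, hh⟩ := exists_orth p _ hG
    refine ⟨h, fun v hv hvn => hh v (mem_erase.2 ⟨hvn j hj, hv⟩), fun v hv hz => h0 ?_⟩
    apply hp1 (insert v (g.erase (u' j)))
    · rw [card_insert_of_notMem (fun hc => hv (mem_of_mem_erase hc)), hG]
    · intro i hi hc
      have hi := (mem_filter.1 hi).2
      have hui : u j ∈ e i := hc ▸ mem_insert_of_mem (mem_erase.2 ⟨(hu j hj).1, hug⟩)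
      by_cases hij : i = j
      · subst hij; exact hi hj
      · exact (hu j hj).2.1.2 i hij hui
    · intro y hy
      rcases mem_insert.1 hy with rfl | hy
      · exact hz
      · exact hh y hy
  have hex : ∀ g : 𝒢, ∃ h : Fin k → ℚ,
      (∀ v ∈ g.1, (∀ j, Ab j → v ≠ u' j) → p v ⬝ᵥ h = 0) ∧ ∀ v, v ∉ g.1 → p v ⬝ᵥ h ≠ 0 := by
    rintro ⟨g, hg⟩
    rcases h𝒢 g hg with ⟨i, rfl⟩ | ⟨z, i, hzi, rfl⟩
    · by_cases hi : Ab i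
      · exact habsorb _ (hek i) i hi (hu i hi).2.1.1 (hu i hi).2.2.1.1
      · obtain ⟨h, h0, hh⟩ := hp2 i (mem_filter.2 ⟨mem_univ _, hi⟩)
        refine ⟨h, fun v hv _ => hh v hv, fun v hv hz => h0 ?_⟩
        obtain ⟨x, hx, _⟩ := ho.ss.ord i
        have hG : ((e i).erase x).card + 1 = k := by rw [card_erase_add_one hx, hek]
        apply hp1 (insert v ((e i).erase x))
        · rw [card_insert_of_notMem (fun hc => hv (mem_of_mem_erase hc)), hG]
        · intro i' _ hc
          have hne : i ≠ i' := by
            rintro rfl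
            have hmem := mem_insert_self v ((e i).erase x)
            rw [hc] at hmem
            exact hv hmem
          have h1 : (e i).erase x ⊆ e i ∩ e i' := by
            intro y hy
            exact mem_inter.2 ⟨mem_of_mem_erase hy, hc ▸ mem_insert_of_mem hy⟩
          have h2 := card_le_card h1
          have h3 := ho.ss.int i i' hne
          omega
        · intro y hy
          rcases mem_insert.1 hy with rfl | hy
          · exact hz
          · exact hh y (mem_of_mem_erase hy)
    · have hi : Ab i := ⟨z, hzi⟩
      have := (hu i hi).2.2.2 z hzi
      obtain ⟨_, w, hsw⟩ := hzi
      exact habsorb _ (hF _ hsw.hf) i hi this.1 this.2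
  choose h hh1 hh2 using hex
  obtain ⟨t, ht⟩ := hC.sys
  refine ⟨𝒢, h𝒢F, hcov, ?_⟩
  have := poly_bound (ι := 𝒢) k b (fun g s => p (π (t g.1 s))) h ?_ ?_
  · rwa [Fintype.card_coe] at this
  · intro g
    rw [Finset.prod_ne_zero_iff]
    intro s _
    apply hh2 g
    rw [← hπg g.1 g.2]
    exact ht.dis g.1 (h𝒢F g.2) s
  · intro g g' hne
    obtain ⟨s, hs⟩ := ht.hit g.1 (h𝒢F g.2) g'.1 (h𝒢F g'.2) (fun hc => hne (Subtype.ext hc))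
    refine Finset.prod_eq_zero (mem_univ s) (hh1 g' _ ?_ (hπne _))
    exact (hπg g'.1 g'.2 _).1 hs

theorem main_bound {k b : ℕ} {F : Finset (Finset V)} (hk : 2 ≤ k) (hC : Crit k b F) :
    Fintype.card V + 1 ≤ (k + b).choose (k - 1) + (k + b - 1).choose (k - 1) := by
  rcases Nat.lt_or_ge 2 k with hk3 | hk2
  · obtain ⟨𝒢, h1, h2, h3⟩ := good_cover hk3 hC
    obtain ⟨t, ht⟩ := hC.sys
    obtain ⟨a, rfl⟩ : ∃ a, k = a + 1 := ⟨k - 1, by omega⟩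
    have h4 := union_step (ht.mono h1) (union_bound (V := V) (b := b) a)
    rw [h2, card_univ] at h4
    have e1 : a + 1 + b - 1 = a + b := by omega
    have e2 : a + 1 - 1 = a := by omega
    have e3 : a + 1 + b = a + b + 1 := by omega
    rw [e1] at h3 ⊢
    rw [e2, e3]
    have h5 : (a + b).choose b = (a + b).choose a := by rw [← Nat.choose_symm_add]
    omega
  · obtain rfl : k = 2 := by omega
    have := two_bound hC
    have e1 : 2 + b - 1 = b + 1 := by omega
    rw [e1]
    simp only [Nat.add_one_sub_one, Nat.choose_one_right]
    omega

end Tuza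

theorem stmt9 (k ℓ n : ℕ) (hk : 2 ≤ k) (hl : 1 ≤ ℓ)
    (hn : Nat.choose (k + ℓ) (k - 1) + Nat.choose (k + ℓ - 1) (k - 1) ≤ n) :
    ¬ ∃ E : Finset (Finset (Fin n)),
        Uniform n k E ∧ Saturated n k (n - ℓ) E ∧ Primitive n k E := by
  classical
  rintro ⟨E, _, ⟨hnc, hsat⟩, hprim⟩
  have hlt : ℓ < n := by
    by_contra hc
    push Not at hc
    apply hnc
    refine ⟨∅, by simp; omega, fun T hT hTk => ?_⟩
    rw [subset_empty.1 hT, card_empty] at hTk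
    omega
  have hC : Tuza.Crit k ℓ (univ.filter fun S : Finset (Fin n) => S.card = k ∧ S ∉ E) := by
    refine ⟨fun e he => (mem_filter.1 he).2.1, ?_, ?_, ?_⟩
    · intro T hT
      obtain ⟨T', hTT', hT'⟩ := exists_superset_card_eq hT (by simp; omega)
      by_contra hcon
      push Not at hcon
      apply hnc
      refine ⟨T'ᶜ, by rw [card_compl, Fintype.card_fin, hT'], fun S hS hSk => ?_⟩
      by_contra hSE
      obtain ⟨v, hv, hvT⟩ := hcon S (mem_filter.2 ⟨mem_univ _, hSk, hSE⟩)
      exact mem_compl.1 (hS hv) (hTT' hvT)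
    · intro S hS
      obtain ⟨_, hSk, hSE⟩ := mem_filter.1 hS
      obtain ⟨Q, hQ, hQ2⟩ := hsat S hSk hSE
      refine ⟨Qᶜ, by rw [card_compl, Fintype.card_fin, hQ]; omega, fun f hf hne => ?_⟩
      obtain ⟨_, hfk, hfE⟩ := mem_filter.1 hf
      by_contra hcon
      push Not at hcon
      rcases hQ2 f (fun v hv => by simpa using hcon v hv) hfk with h | h
      · exact hfE h
      · exact hne h
    · intro v
      by_contra hcon
      push Not at hcon
      apply hprim
      refine ⟨v, fun S hSk hvS => ?_⟩
      by_contra hSE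
      exact hcon S (mem_filter.2 ⟨mem_univ _, hSk, hSE⟩) hvS
  have := Tuza.main_bound hk hC
  rw [Fintype.card_fin] at this
  omega
end

section
/- Let r,n be integers with 3 < r < n satisfying C(n-r+3, 2) ≥ n and n ≥ 2(n-r)+4 if n-r is odd, n ≥ 2(n-r)+3 if n-r is even. Then there exists a primitive uniquely K_r^(3)-saturated hypergraph on n vertices. -/
open Finset

lemma refine_col {α : Type*} [DecidableEq α] (X : Finset α) (f : α → ℕ) (k : ℕ)
    (h1 : (X.image f).card ≤ k) (h2 : k ≤ X.card) :
    ∃ g : α → ℕ, (X.image g).card = k ∧ ∀ x ∈ X, ∀ y ∈ X, g x = g y → f x = f y := by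
  induction k, h1 using Nat.le_induction with
  | base => exact ⟨f, rfl, fun x _ y _ h => h⟩
  | succ k hk ih =>
    obtain ⟨g, hg, hp⟩ := ih (by omega)
    obtain ⟨x, hx, y, hy, hxy, hgxy⟩ : ∃ x ∈ X, ∃ y ∈ X, x ≠ y ∧ g x = g y := by
      by_contra! hcon
      have : (X.image g).card = X.card := by
        apply Finset.card_image_of_injOn
        intro x hx y hy hxy
        by_contra hne
        exact hcon x hx y hy hne hxy
      omega
    obtain ⟨z, hz⟩ := Infinite.exists_notMem_finset (X.image g)
    have hz' : ∀ w ∈ X, g w ≠ z := by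
      intro w hw h
      exact hz (Finset.mem_image.2 ⟨w, hw, h⟩)
    refine ⟨Function.update g x z, ?_, ?_⟩
    · have : X.image (Function.update g x z) = insert z (X.image g) := by
        ext t
        simp only [Finset.mem_image, Finset.mem_insert]
        constructor
        · rintro ⟨w, hw, rfl⟩
          by_cases h : w = x
          · left; simp [h]
          · right; exact ⟨w, hw, by simp [h]⟩
        · rintro (rfl | ⟨w, hw, rfl⟩)
          · exact ⟨x, hx, by simp⟩
          · by_cases h : w = x
            · exact ⟨y, hy, by simp [h, hgxy, Ne.symm hxy]⟩
            · exact ⟨w, hw, by simp [h]⟩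
      rw [this, Finset.card_insert_of_notMem hz, hg]
    · intro u hu v hv huv
      by_cases h : u = x <;> by_cases h' : v = x
      · rw [h, h']
      · simp only [h, Function.update_self, Function.update_of_ne h'] at huv
        exact absurd huv.symm (hz' v hv)
      · simp only [h', Function.update_self, Function.update_of_ne h] at huv
        exact absurd huv (hz' u hu)
      · simp only [Function.update_of_ne h, Function.update_of_ne h'] at huv
        exact hp u hu v hv huv

lemma mod_inj (M a b c : ℕ) (ha : a < M) (hb : b < M) (h : (c + a) % M = (c + b) % M) : a = b := by
  have h' : a ≡ b [MOD M] := Nat.ModEq.add_left_cancel' c h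
  rwa [Nat.ModEq, Nat.mod_eq_of_lt ha, Nat.mod_eq_of_lt hb] at h'

lemma dbl_inj (M a b : ℕ) (hM : Odd M) (ha : a < M) (hb : b < M)
    (h : (2 * a) % M = (2 * b) % M) : a = b := by
  have h' : a ≡ b [MOD M] := Nat.ModEq.cancel_left_of_coprime (c := 2)
    (Nat.coprime_two_right.2 hM) h
  rwa [Nat.ModEq, Nat.mod_eq_of_lt ha, Nat.mod_eq_of_lt hb] at h'

/-- proper edge colouring of the complete graph on `N` vertices -/
lemma base_col (N K : ℕ) (hN : 2 ≤ N) (ho : Odd N → N ≤ K) (he : Even N → N - 1 ≤ K) :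
    ∃ f : ℕ → ℕ → ℕ, (∀ i j, f i j = f j i) ∧ (∀ i j, f i j < K) ∧
      ∀ i < N, ∀ j < N, ∀ l < N, i ≠ j → i ≠ l → f i j = f i l → j = l := by
  rcases Nat.even_or_odd N with h | h
  · have hK := he h
    obtain ⟨M, rfl⟩ : ∃ M, N = M + 1 := ⟨N - 1, by omega⟩
    have hM : Odd M := by
      by_contra hcon
      rw [Nat.not_odd_iff_even] at hcon
      exact (Nat.not_odd_iff_even.2 h) hcon.add_one
    have hM0 : 0 < M := by omega
    refine ⟨fun i j => if i = M then (2 * j) % M else if j = M then (2 * i) % M else (i + j) % M,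
      ?_, ?_, ?_⟩
    · intro i j
      dsimp only
      split_ifs <;> simp_all [Nat.add_comm]
    · intro i j
      have h1 := Nat.mod_lt (2 * j) hM0
      have h2 := Nat.mod_lt (2 * i) hM0
      have h3 := Nat.mod_lt (i + j) hM0
      dsimp only
      split_ifs <;> omega
    · intro i hi j hj l hl hij hil h
      dsimp only at h
      split_ifs at h with h1 h2 h3 h4
      · exact dbl_inj M j l hM (by omega) (by omega) h
      · omega
      · rw [two_mul] at h
        exact absurd (mod_inj M i l i (by omega) (by omega) h) hil
      · rw [two_mul] at h
        exact absurd (mod_inj M j i i (by omega) (by omega) h).symm hij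
      · exact mod_inj M j l i (by omega) (by omega) h
  · have hK := ho h
    refine ⟨fun i j => (i + j) % N, fun i j => by simp [Nat.add_comm], ?_, ?_⟩
    · intro i j
      exact lt_of_lt_of_le (Nat.mod_lt _ (by omega)) hK
    · intro i _ j hj l hl _ _ h
      exact mod_inj N j l i hj hl h

/-- the colouring, with colours being the vertices outside `A` -/
lemma exists_col (n m : ℕ) (hm : m + 2 ≤ n) (h1 : n ≤ Nat.choose (m + 3) 2)
    (h2odd : Odd m → 2 * m + 4 ≤ n) (h2even : Even m → 2 * m + 3 ≤ n) :
    ∃ (A : Finset (Fin n)) (c : Fin n → Fin n → Fin n), A.card = m + 2 ∧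
      (∀ a b, c a b = c b a) ∧ (∀ a ∈ A, ∀ b ∈ A, a ≠ b → c a b ∉ A) ∧
      (∀ a ∈ A, ∀ b ∈ A, ∀ d ∈ A, a ≠ b → a ≠ d → c a b = c a d → b = d) ∧
      (∀ v ∉ A, ∃ a ∈ A, ∃ b ∈ A, a ≠ b ∧ c a b = v) := by
  classical
  obtain ⟨f, fs, fb, fp⟩ := base_col (m + 2) (n - (m + 2)) (by omega)
    (fun h => by
      have : Odd m := by
        rcases Nat.even_or_odd m with h' | h'
        · exact absurd h (Nat.not_odd_iff_even.2 (h'.add even_two))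
        · exact h'
      have := h2odd this
      omega)
    (fun h => by
      have : Even m := by
        rcases Nat.even_or_odd m with h' | h'
        · exact h'
        · exact absurd h (Nat.not_even_iff_odd.2 (h'.add_even even_two))
      have := h2even this
      omega)
  let A : Finset (Fin n) := Finset.univ.filter (fun v => v.val < m + 2)
  have hmA : ∀ v, v ∈ A ↔ v.val < m + 2 := by intro v; simp [A]
  have hA : A.card = m + 2 := by
    have : A = (Finset.univ : Finset (Fin (m+2))).map (Fin.castLEEmb hm) := by
      ext v
      simp only [hmA, Finset.mem_map, Finset.mem_univ, true_and]
      constructor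
      · intro h
        exact ⟨⟨v.val, h⟩, by ext; simp⟩
      · rintro ⟨w, rfl⟩
        simp
    rw [this]; simp
  let X : Finset (Sym2 (Fin n)) := A.offDiag.image Sym2.mk.uncurry
  have hX : X.card = (m + 2).choose 2 := by
    rw [← hA]; exact Sym2.card_image_offDiag A
  have hmX : ∀ a ∈ A, ∀ b ∈ A, a ≠ b → s(a, b) ∈ X := by
    intro a ha b hb hab
    exact Finset.mem_image.2 ⟨(a, b), by simp [ha, hb, hab], rfl⟩
  let F : Sym2 (Fin n) → ℕ := Sym2.lift ⟨fun i j => f i j, fun i j => fs i j⟩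
  obtain ⟨g, hg, hgp⟩ := refine_col X F (n - (m + 2))
    (by
      calc (X.image F).card ≤ (Finset.range (n - (m+2))).card := by
            apply Finset.card_le_card
            intro t ht
            obtain ⟨z, _, rfl⟩ := Finset.mem_image.1 ht
            induction z with
            | _ a b => exact Finset.mem_range.2 (fb _ _)
        _ = _ := by simp)
    (by
      rw [hX]
      have : (m + 3).choose 2 = (m + 2).choose 1 + (m+2).choose 2 := Nat.choose_succ_succ _ _
      simp at this
      omega)
  have hAc : Aᶜ.card = n - (m + 2) := by rw [Finset.card_compl, hA]; simp
  have e : (X.image g) ≃ (Aᶜ : Finset (Fin n)) := Finset.equivOfCardEq (by rw [hg, hAc])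
  let c : Fin n → Fin n → Fin n := fun a b =>
    if h : g s(a, b) ∈ X.image g then (e ⟨_, h⟩).val else a ⊔ b
  have hc : ∀ a ∈ A, ∀ b ∈ A, a ≠ b → ∃ h : g s(a, b) ∈ X.image g, c a b = (e ⟨_, h⟩).val := by
    intro a ha b hb hab
    have h : g s(a, b) ∈ X.image g := Finset.mem_image_of_mem _ (hmX a ha b hb hab)
    exact ⟨h, by simp only [c]; rw [dif_pos h]⟩
  refine ⟨A, c, hA, ?_, ?_, ?_, ?_⟩
  · intro a b
    simp only [c, Sym2.eq_swap (a := a) (b := b), sup_comm]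
  · intro a ha b hb hab
    obtain ⟨h, h'⟩ := hc a ha b hb hab
    rw [h']
    exact Finset.mem_compl.1 (e _).2
  · intro a ha b hb d hd hab had heq
    obtain ⟨h, h'⟩ := hc a ha b hb hab
    obtain ⟨k, k'⟩ := hc a ha d hd had
    rw [h', k'] at heq
    have := e.injective (Subtype.ext heq)
    have := hgp _ (hmX a ha b hb hab) _ (hmX a ha d hd had) (congrArg Subtype.val this)
    have := fp a ((hmA a).1 ha) b ((hmA b).1 hb) d ((hmA d).1 hd)
      (fun h => hab (Fin.ext h)) (fun h => had (Fin.ext h)) this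
    exact Fin.ext this
  · intro v hv
    obtain ⟨⟨t, ht⟩, hte⟩ := e.surjective ⟨v, Finset.mem_compl.2 hv⟩
    obtain ⟨z, hz, rfl⟩ := Finset.mem_image.1 ht
    obtain ⟨⟨a, b⟩, hab, rfl⟩ := Finset.mem_image.1 hz
    simp only [Finset.mem_offDiag] at hab
    obtain ⟨ha, hb, hab⟩ := hab
    refine ⟨a, ha, b, hb, hab, ?_⟩
    obtain ⟨h, h'⟩ := hc a ha b hb hab
    rw [h']
    exact congrArg Subtype.val hte

theorem stmt12 (r n : ℕ) (hr : 3 < r) (hrn : r < n)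
    (h1 : n ≤ Nat.choose (n - r + 3) 2)
    (h2odd : Odd (n - r) → 2 * (n - r) + 4 ≤ n)
    (h2even : Even (n - r) → 2 * (n - r) + 3 ≤ n) :
    ∃ E : Finset (Finset (Fin n)), IsPUS n 3 r E := by
  classical
  obtain ⟨m, hm⟩ : ∃ m, m = n - r := ⟨_, rfl⟩
  rw [← hm] at h1 h2odd h2even
  obtain ⟨A, c, hA, cs, cA, cp, csurj⟩ := exists_col n m (by omega) h1 h2odd h2even
  have hAc : Aᶜ.card = n - (m + 2) := by rw [Finset.card_compl, hA]; simp
  let F : Finset (Fin n) → Prop := fun S => ∃ a ∈ A, ∃ b ∈ A, a ≠ b ∧ S = {a, b, c a b}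
  let E : Finset (Finset (Fin n)) := Finset.univ.filter (fun S => S.card = 3 ∧ ¬ F S)
  have hE : ∀ S, S ∈ E ↔ S.card = 3 ∧ ¬ F S := by intro S; simp [E]
  have F3 : ∀ a ∈ A, ∀ b ∈ A, a ≠ b → ({a, b, c a b} : Finset (Fin n)).card = 3 := by
    intro a ha b hb hab
    have := cA a ha b hb hab
    rw [Finset.card_eq_three]
    exact ⟨a, b, c a b, hab, fun h => this (h ▸ ha), fun h => this (h ▸ hb), rfl⟩
  have hQ2 : ∀ Q : Finset (Fin n), Q.card = r → (Q ∩ A).card + (Q \ A).card = r ∧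
      2 ≤ (Q ∩ A).card := by
    intro Q hQ
    have h1 := Finset.card_inter_add_card_sdiff Q A
    have h2 : (Q \ A).card ≤ Aᶜ.card := Finset.card_le_card (by
      intro x hx; simp at hx ⊢; exact hx.2)
    omega
  have key : ∀ Q : Finset (Fin n), Q.card = r → ∀ x ∈ Q, x ∈ A →
      ∃ y ∈ Q, y ∈ A ∧ x ≠ y ∧ c x y ∈ Q := by
    intro Q hQ x hxQ hxA
    by_contra! hcon
    obtain ⟨h3, h4⟩ := hQ2 Q hQ
    have h5 : ((Q ∩ A).erase x).card ≤ (Aᶜ \ (Q \ A)).card := by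
      apply Finset.card_le_card_of_injOn (c x)
      · intro y hy
        simp at hy
        have h6 := hcon y hy.1.1 hy.1.2 (Ne.symm hy.2)
        have h7 := cA x hxA y hy.1.2 (Ne.symm hy.2)
        simp [h6, h7]
      · intro y hy z hz h
        simp at hy hz
        exact cp x hxA y hy.1.2 z hz.1.2 (Ne.symm hy.2) (Ne.symm hz.2) h
    rw [Finset.card_erase_of_mem (by simp [hxQ, hxA]), Finset.card_sdiff_of_subset (by
      intro x hx; simp at hx ⊢; exact hx.2)] at h5
    omega
  refine ⟨E, fun e he => ((hE e).1 he).1, ⟨?_, ?_⟩, ?_⟩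
  · rintro ⟨Q, hQ, hT⟩
    obtain ⟨_, h4⟩ := hQ2 Q hQ
    obtain ⟨x, hx⟩ := Finset.card_pos.1 (show 0 < (Q ∩ A).card by omega)
    rw [Finset.mem_inter] at hx
    obtain ⟨y, hy, hyA, hxy, hc⟩ := key Q hQ x hx.1 hx.2
    have := hT {x, y, c x y} (by
      intro z hz; simp at hz; rcases hz with rfl | rfl | rfl <;> [exact hx.1; exact hy; exact hc])
      (F3 x hx.2 y hyA hxy)
    exact ((hE _).1 this).2 ⟨x, hx.2, y, hyA, hxy, rfl⟩
  · intro S hS hSE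
    have : F S := by
      by_contra h
      exact hSE ((hE S).2 ⟨hS, h⟩)
    obtain ⟨a, ha, b, hb, hab, rfl⟩ := this
    have hcab := cA a ha b hb hab
    have hcard : (Aᶜ ∪ {a, b}).card = r := by
      rw [Finset.card_union_of_disjoint, hAc, Finset.card_pair hab]
      · omega
      · rw [Finset.disjoint_left]
        intro z hz hz'
        simp at hz hz'
        rcases hz' with rfl | rfl <;> contradiction
    refine ⟨Aᶜ ∪ {a, b}, ⟨hcard, ?_⟩, ?_⟩
    · intro T hT hT3
      by_contra! hcon
      have : F T := by
        by_contra h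
        exact hcon.1 ((hE T).2 ⟨hT3, h⟩)
      obtain ⟨x, hx, y, hy, hxy, rfl⟩ := this
      have hx' := hT (show x ∈ _ by simp)
      have hy' := hT (show y ∈ _ by simp)
      simp [hx, hy] at hx' hy'
      apply hcon.2
      rcases hx' with rfl | rfl <;> rcases hy' with rfl | rfl
      · exact absurd rfl hxy
      · rfl
      · rw [cs x y]; ext z; simp; tauto
      · exact absurd rfl hxy
    · rintro Q ⟨hQ, hT⟩
      apply Finset.eq_of_subset_of_card_le
      · intro x hx
        by_contra hcon
        simp at hcon
        obtain ⟨hxa, hxb, hxA⟩ := hcon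
        obtain ⟨y, hy, hyA, hxy, hc⟩ := key Q hQ x hx hxA
        rcases hT {x, y, c x y} (by
          intro z hz; simp at hz
          rcases hz with rfl | rfl | rfl <;> [exact hx; exact hy; exact hc])
          (F3 x hxA y hyA hxy) with h | h
        · exact ((hE _).1 h).2 ⟨x, hxA, y, hyA, hxy, rfl⟩
        · have : x ∈ ({a, b, c a b} : Finset (Fin n)) := h ▸ (by simp)
          simp [hxa, hxb] at this
          exact hcab (this ▸ hxA)
      · rw [hcard, hQ]
  · rintro ⟨v, hv⟩
    by_cases hvA : v ∈ A
    · obtain ⟨w, hw, hwv⟩ := Finset.exists_mem_ne (show 1 < A.card by omega) v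
      exact ((hE _).1 (hv {v, w, c v w} (F3 v hvA w hw (Ne.symm hwv)) (by simp))).2
        ⟨v, hvA, w, hw, Ne.symm hwv, rfl⟩
    · obtain ⟨a, ha, b, hb, hab, rfl⟩ := csurj v hvA
      exact ((hE _).1 (hv {a, b, c a b} (F3 a ha b hb hab) (by simp))).2
        ⟨a, ha, b, hb, hab, rfl⟩
end
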